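/- In the additive spiked model with aspect ratio p/n → δ ≥ 0 and fixed signal strength λ satisfying λ < δ^{1/4}, the inner product ⟨v̂, v*⟩ between the top unit eigenvector v̂ of XᵀX and the true spike direction v* converges in probability to 0 as n → ∞. -/

import Mathlib

open MeasureTheory ProbabilityTheory Filter Matrix
open scoped NNReal ENNReal

noncomputable section

/-- Euclidean inner product on `Fin m → ℝ`. -/
def dotp {m : ℕ} (v w : Fin m → ℝ) : ℝ := ∑ j, v j * w j

/-- `v` is a unit-norm eigenvector of the square matrix `M` associated with its
largest eigenvalue. -/
def IsTopUnitEigenvector {m : ℕ} (M : Matrix (Fin m) (Fin m) ℝ) (v : Fin m → ℝ) : Prop :=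
  dotp v v = 1 ∧ ∃ c : ℝ, M.mulVec v = c • v ∧
    ∀ c' : ℝ, ∀ w : Fin m → ℝ, w ≠ 0 → M.mulVec w = c' • w → c' ≤ c

/-- The law of the randomness `(u, Z)` in the additive spiked model: `u ∈ ℝⁿ` has i.i.d.
`N(0, 1/n)` entries, and independently `Z ∈ ℝ^{n×p}` has i.i.d. `N(0, 1/n)` entries. -/
def spikedLaw (n p : ℕ) : Measure ((Fin n → ℝ) × (Fin n → Fin p → ℝ)) :=
  (Measure.pi fun _ : Fin n => gaussianReal 0 (n : ℝ≥0)⁻¹).prod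
    (Measure.pi fun _ : Fin n => Measure.pi fun _ : Fin p => gaussianReal 0 (n : ℝ≥0)⁻¹)

/-- The data matrix `X = λ u v*ᵀ + Z` of the additive spiked model. -/
def spikedMatrix {n p : ℕ} (lam : ℝ) (vstar : Fin p → ℝ) (u : Fin n → ℝ)
    (Z : Fin n → Fin p → ℝ) : Matrix (Fin n) (Fin p) ℝ :=
  Matrix.of fun i j => lam * u i * vstar j + Z i j


lemma cf_pi {ι : Type*} [Fintype ι] (v : ℝ≥0) (a : ι → ℝ) :
    ∫ x : ι → ℝ, Complex.exp (((∑ i, a i * x i : ℝ) : ℂ) * Complex.I)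
      ∂(Measure.pi fun _ : ι => gaussianReal 0 v)
    = Complex.exp (-(((v : ℝ) * ∑ i, a i ^ 2 : ℝ) : ℂ) / 2) := by
  have h : ∀ x : ι → ℝ, Complex.exp (((∑ i, a i * x i : ℝ) : ℂ) * Complex.I)
      = ∏ i, Complex.exp ((a i : ℂ) * (x i : ℂ) * Complex.I) := by
    intro x
    rw [← Complex.exp_sum, ← Finset.sum_mul]
    push_cast; rfl
  simp_rw [h]
  rw [integral_fintype_prod_eq_prod (f := fun i (x : ℝ) => Complex.exp ((a i : ℂ) * (x : ℂ) * Complex.I))]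
  have h2 : ∀ i, ∫ x : ℝ, Complex.exp ((a i : ℂ) * (x : ℂ) * Complex.I) ∂(gaussianReal 0 v)
      = Complex.exp (-(((v : ℝ) * a i ^ 2 : ℝ) : ℂ) / 2) := by
    intro i
    rw [← charFun_apply_real, charFun_gaussianReal]
    congr 1
    push_cast; ring
  simp_rw [h2]
  rw [← Complex.exp_sum]
  congr 1
  push_cast
  rw [Finset.mul_sum, ← Finset.sum_div, ← Finset.sum_neg_distrib]

lemma cf_pi_pi {ι κ : Type*} [Fintype ι] [Fintype κ] (v : ℝ≥0) (b : ι → κ → ℝ) :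
    ∫ x : ι → κ → ℝ, Complex.exp (((∑ i, ∑ j, b i j * x i j : ℝ) : ℂ) * Complex.I)
      ∂(Measure.pi fun _ : ι => Measure.pi fun _ : κ => gaussianReal 0 v)
    = Complex.exp (-(((v : ℝ) * ∑ i, ∑ j, b i j ^ 2 : ℝ) : ℂ) / 2) := by
  have h : ∀ x : ι → κ → ℝ, Complex.exp (((∑ i, ∑ j, b i j * x i j : ℝ) : ℂ) * Complex.I)
      = ∏ i, Complex.exp (((∑ j, b i j * x i j : ℝ) : ℂ) * Complex.I) := by
    intro x
    rw [← Complex.exp_sum, ← Finset.sum_mul]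
    push_cast; rfl
  simp_rw [h]
  rw [integral_fintype_prod_eq_prod (f := fun i (x : κ → ℝ) => Complex.exp (((∑ j, b i j * x j : ℝ) : ℂ) * Complex.I))]
  simp_rw [cf_pi]
  rw [← Complex.exp_sum]
  congr 1
  push_cast
  rw [Finset.mul_sum, ← Finset.sum_div, ← Finset.sum_neg_distrib]

lemma rot_pi {n : ℕ} (v : ℝ≥0) (U : Matrix (Fin n) (Fin n) ℝ) (hU : U * Uᵀ = 1) :
    MeasurePreserving (fun w : Fin n → ℝ => U *ᵥ w)
      (Measure.pi fun _ : Fin n => gaussianReal 0 v) (Measure.pi fun _ : Fin n => gaussianReal 0 v) := by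
  have hm : Measurable (fun w : Fin n → ℝ => U *ᵥ w) :=
    (Continuous.matrix_mulVec continuous_const continuous_id).measurable
  refine ⟨hm, ?_⟩
  have : IsProbabilityMeasure (Measure.map (fun w : Fin n → ℝ => U *ᵥ w) (Measure.pi fun _ : Fin n => gaussianReal 0 v)) :=
    Measure.isProbabilityMeasure_map hm.aemeasurable
  apply Measure.ext_of_charFunDual
  ext L
  rw [charFunDual_apply, charFunDual_apply, integral_map hm.aemeasurable (by fun_prop)]
  obtain ⟨a, hL⟩ : ∃ a : Fin n → ℝ, ∀ x : Fin n → ℝ, L x = ∑ i, a i * x i := by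
    refine ⟨fun i => L (Pi.single i 1), ?_⟩
    intro x
    conv_lhs => rw [← Finset.univ_sum_single x]
    rw [map_sum]
    refine Finset.sum_congr rfl fun i _ => ?_
    have : (Pi.single i (x i) : Fin n → ℝ) = x i • Pi.single i 1 := by
      rw [← Pi.single_smul]; simp
    rw [this, map_smul]; simp [mul_comm]
  have hL2 : ∀ x : Fin n → ℝ, L (U *ᵥ x) = ∑ i, (Uᵀ *ᵥ a) i * x i := by
    intro x
    rw [hL]
    change a ⬝ᵥ (U *ᵥ x) = (Uᵀ *ᵥ _) ⬝ᵥ x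
    rw [dotProduct_mulVec, mulVec_transpose]
  simp_rw [hL2]
  rw [cf_pi]
  simp_rw [hL]
  rw [cf_pi]
  congr 5
  have e : ∀ a : Fin n → ℝ, ∑ i, a i ^ 2 = a ⬝ᵥ a := by
    intro a; simp [dotProduct, sq]
  rw [e, e, dotProduct_mulVec, ← mulVec_transpose, transpose_transpose, mulVec_mulVec, hU, one_mulVec]

def gC : ℝ := Var[fun x : ℝ => x ^ 2; gaussianReal 0 1]

lemma gC_nonneg : 0 ≤ gC := variance_nonneg _ _

lemma memLp_sq_gauss (v : ℝ≥0) : MemLp (fun x : ℝ => x ^ 2) 2 (gaussianReal 0 v) := by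
  have h := memLp_id_gaussianReal' (μ := 0) (v := v) 4 (by simp)
  have := h.norm_rpow_div (q := 2)
  have e : (4 : ℝ≥0∞) / 2 = 2 := by
    rw [show (4 : ℝ≥0∞) = 2 * 2 by norm_num, mul_div_assoc, ENNReal.div_self (by simp) (by simp), mul_one]
  rw [e] at this
  refine this.congr_norm (by fun_prop) ?_
  filter_upwards with x
  simp

lemma integral_sq_gauss (v : ℝ≥0) : ∫ x, x ^ 2 ∂(gaussianReal 0 v) = v := by
  have h := variance_id_gaussianReal (μ := 0) (v := v)
  rw [variance_eq_integral (by fun_prop)] at h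
  simpa using h

lemma var_sq_gauss (v : ℝ≥0) : Var[fun x : ℝ => x ^ 2; gaussianReal 0 v] = (v : ℝ) ^ 2 * gC := by
  have h : gaussianReal 0 v = (gaussianReal 0 1).map (fun x => Real.sqrt v * x) := by
    rw [gaussianReal_map_const_mul]
    congr 1
    · simp
    · ext; simp
  rw [h, variance_map (by fun_prop) (by fun_prop)]
  have : ((fun x : ℝ => x ^ 2) ∘ fun x => Real.sqrt v * x) = fun x => (v : ℝ) * x ^ 2 := by
    funext x; simp [mul_pow]
  rw [this, variance_const_mul, gC]

lemma diag_real {n : ℕ} (v : ℝ≥0) (d : Fin n → ℝ) :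
    Integrable (fun w : Fin n → ℝ => (∑ i, d i * (w i ^ 2 - v)) ^ 2) (Measure.pi fun _ : Fin n => gaussianReal 0 v) ∧
    ∫ w : Fin n → ℝ, (∑ i, d i * (w i ^ 2 - v)) ^ 2 ∂(Measure.pi fun _ : Fin n => gaussianReal 0 v)
      = (v : ℝ) ^ 2 * gC * ∑ i, d i ^ 2 := by
  have hX : ∀ i, MemLp (fun x : ℝ => d i * (x ^ 2 - v)) 2 (gaussianReal 0 v) := fun i =>
    ((memLp_sq_gauss v).sub (memLp_const _)).const_mul _
  have h := variance_sum_pi (μ := fun _ : Fin n => gaussianReal 0 v) (X := fun i x => d i * (x ^ 2 - v)) hX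
  have hX' : ∀ i, MemLp (fun w : Fin n → ℝ => d i * (w i ^ 2 - v)) 2 (Measure.pi fun _ : Fin n => gaussianReal 0 v) := by
    intro i
    exact (hX i).comp_measurePreserving (measurePreserving_eval (fun _ : Fin n => gaussianReal 0 v) i)
  have hS : MemLp (fun w : Fin n → ℝ => ∑ i, d i * (w i ^ 2 - v)) 2 (Measure.pi fun _ : Fin n => gaussianReal 0 v) :=
    memLp_finsetSum _ (fun i _ => hX' i)
  refine ⟨hS.integrable_sq, ?_⟩
  have hm : ∫ w : Fin n → ℝ, ∑ i, d i * (w i ^ 2 - v) ∂(Measure.pi fun _ : Fin n => gaussianReal 0 v) = 0 := by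
    rw [integral_finsetSum _ (fun i _ => (hX' i).integrable (by norm_num))]
    refine Finset.sum_eq_zero fun i _ => ?_
    rw [integral_comp_eval (μ := fun _ : Fin n => gaussianReal 0 v) (i := i) (f := fun x => d i * (x ^ 2 - v)) (by fun_prop)]
    rw [integral_const_mul, integral_sub ((memLp_sq_gauss v).integrable (by norm_num)) (by simp), integral_sq_gauss]
    simp
  have hs : (∑ i, fun ω : Fin n → ℝ => d i * (ω i ^ 2 - v)) = fun w : Fin n → ℝ => ∑ i, d i * (w i ^ 2 - v) := by
    funext w; simp
  rw [hs, variance_eq_integral hS.aemeasurable, hm] at h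
  simp only [sub_zero] at h
  rw [h, Finset.mul_sum]
  refine Finset.sum_congr rfl fun i _ => ?_
  rw [variance_const_mul, variance_sub_const (memLp_sq_gauss v).aestronglyMeasurable, var_sq_gauss]
  ring


def cv {n : ℕ} (w : Fin n → ℝ) : Fin n → ℂ := fun i => (w i : ℂ)

def Rz {n : ℕ} (K : Matrix (Fin n) (Fin n) ℝ) (z : ℂ) : Matrix (Fin n) (Fin n) ℂ :=
  (z • (1 : Matrix (Fin n) (Fin n) ℂ) - K.map Complex.ofReal)⁻¹

def qf {n : ℕ} (M : Matrix (Fin n) (Fin n) ℂ) (w : Fin n → ℝ) : ℂ := cv w ⬝ᵥ (M *ᵥ cv w)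

lemma psd_diag {n : ℕ} {K : Matrix (Fin n) (Fin n) ℝ} (hK : K.PosSemidef) :
    ∃ (U : Matrix (Fin n) (Fin n) ℝ) (κ : Fin n → ℝ), U * Uᵀ = 1 ∧ Uᵀ * U = 1 ∧ (∀ i, 0 ≤ κ i) ∧
      K = U * diagonal κ * Uᵀ := by
  have hH := hK.isHermitian
  refine ⟨(hH.eigenvectorUnitary : Matrix (Fin n) (Fin n) ℝ), hH.eigenvalues, ?_, ?_, hK.eigenvalues_nonneg, ?_⟩
  · have := Unitary.coe_mul_star_self hH.eigenvectorUnitary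
    rwa [Unitary.coe_star, star_eq_conjTranspose, conjTranspose_eq_transpose_of_trivial] at this
  · have := Unitary.coe_star_mul_self hH.eigenvectorUnitary
    rwa [star_eq_conjTranspose, conjTranspose_eq_transpose_of_trivial] at this
  · have := hH.spectral_theorem
    rw [Unitary.conjStarAlgAut_apply] at this
    rw [star_eq_conjTranspose, conjTranspose_eq_transpose_of_trivial] at this
    exact this

lemma z_sub_ne {z : ℂ} (hz : 0 < z.im) (x : ℝ) : z - (x : ℂ) ≠ 0 := by
  intro h
  have := congrArg Complex.im h
  simp at this
  linarith

lemma cv_mulVec {n : ℕ} (U : Matrix (Fin n) (Fin n) ℝ) (w : Fin n → ℝ) :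
    cv (U *ᵥ w) = U.map Complex.ofReal *ᵥ cv w := by
  funext i; simp [cv, mulVec, dotProduct]

lemma cv_dot {n : ℕ} (a b : Fin n → ℝ) : cv a ⬝ᵥ cv b = ((a ⬝ᵥ b : ℝ) : ℂ) := by
  simp [cv, dotProduct]

structure RD {n : ℕ} (K : Matrix (Fin n) (Fin n) ℝ) (z : ℂ) (U : Matrix (Fin n) (Fin n) ℝ)
    (κ : Fin n → ℝ) : Prop where
  UU : U * Uᵀ = 1
  UU' : Uᵀ * U = 1
  nn : ∀ i, 0 ≤ κ i
  eqK : K = U * diagonal κ * Uᵀ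
  mul_left : Rz K z * (z • (1 : Matrix (Fin n) (Fin n) ℂ) - K.map Complex.ofReal) = 1
  mul_right : (z • (1 : Matrix (Fin n) (Fin n) ℂ) - K.map Complex.ofReal) * Rz K z = 1
  eqR : Rz K z = U.map Complex.ofReal * diagonal (fun i => (z - κ i)⁻¹) * Uᵀ.map Complex.ofReal

lemma exists_RD {n : ℕ} {K : Matrix (Fin n) (Fin n) ℝ} (hK : K.PosSemidef) {z : ℂ} (hz : 0 < z.im) :
    ∃ U κ, RD K z U κ := by
  obtain ⟨U, κ, h1, h2, h3, h4⟩ := psd_diag hK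
  have h1c : U.map Complex.ofReal * Uᵀ.map Complex.ofReal = 1 := by
    have := congrArg (fun M : Matrix (Fin n) (Fin n) ℝ => M.map Complex.ofRealHom) h1
    simp only [Matrix.map_mul] at this
    rw [Matrix.map_one _ (by simp) (by simp)] at this
    exact this
  have h2c : Uᵀ.map Complex.ofReal * U.map Complex.ofReal = 1 := mul_eq_one_comm.mp h1c
  have hKc : K.map Complex.ofReal = U.map Complex.ofReal * diagonal (fun i => (κ i : ℂ)) * Uᵀ.map Complex.ofReal := by
    have := congrArg (fun M : Matrix (Fin n) (Fin n) ℝ => M.map Complex.ofRealHom) h4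
    simp only [Matrix.map_mul] at this
    rw [Matrix.diagonal_map (by simp)] at this
    exact this
  have hz1 : z • (1 : Matrix (Fin n) (Fin n) ℂ) - K.map Complex.ofReal
      = U.map Complex.ofReal * diagonal (fun i => z - (κ i : ℂ)) * Uᵀ.map Complex.ofReal := by
    have : diagonal (fun i => z - (κ i : ℂ)) = z • (1 : Matrix (Fin n) (Fin n) ℂ) - diagonal (fun i => (κ i : ℂ)) := by
      rw [smul_one_eq_diagonal, diagonal_sub]
    rw [this, hKc, mul_sub, sub_mul]
    simp [h1c]
  have hl : (U.map Complex.ofReal * diagonal (fun i => (z - κ i)⁻¹) * Uᵀ.map Complex.ofReal) *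
      (z • (1 : Matrix (Fin n) (Fin n) ℂ) - K.map Complex.ofReal) = 1 := by
    rw [hz1]
    calc _ = U.map Complex.ofReal * diagonal (fun i => (z - κ i)⁻¹) * (Uᵀ.map Complex.ofReal *
          U.map Complex.ofReal) * diagonal (fun i => z - (κ i : ℂ)) * Uᵀ.map Complex.ofReal := by
            simp only [Matrix.mul_assoc]
      _ = 1 := by
        rw [h2c, mul_one, Matrix.mul_assoc (U.map Complex.ofReal), diagonal_mul_diagonal]
        have : (fun i => (z - (κ i : ℂ))⁻¹ * (z - (κ i : ℂ))) = fun _ => 1 := by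
          funext i; exact inv_mul_cancel₀ (z_sub_ne hz _)
        rw [this, diagonal_one, mul_one, h1c]
  have hR : Rz K z = U.map Complex.ofReal * diagonal (fun i => (z - κ i)⁻¹) * Uᵀ.map Complex.ofReal :=
    inv_eq_left_inv hl
  refine ⟨U, κ, h1, h2, h3, h4, ?_, ?_, hR⟩
  · rw [hR, hl]
  · rw [hR]; exact mul_eq_one_comm.mp hl

namespace RD
variable {n : ℕ} {K : Matrix (Fin n) (Fin n) ℝ} {z : ℂ} {U : Matrix (Fin n) (Fin n) ℝ} {κ : Fin n → ℝ}

lemma trace (h : RD K z U κ) : (Rz K z).trace = ∑ i, (z - κ i)⁻¹ := by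
  have h2c : Uᵀ.map Complex.ofReal * U.map Complex.ofReal = 1 := by
    have := congrArg (fun M : Matrix (Fin n) (Fin n) ℝ => M.map Complex.ofRealHom) h.UU'
    simp only [Matrix.map_mul] at this
    rw [Matrix.map_one _ (by simp) (by simp)] at this
    exact this
  rw [h.eqR, Matrix.mul_assoc, Matrix.trace_mul_comm, Matrix.mul_assoc, h2c, mul_one, trace_diagonal]

lemma bil (h : RD K z U κ) (a b : Fin n → ℝ) : cv a ⬝ᵥ (Rz K z *ᵥ cv b)
    = ∑ i, ((Uᵀ *ᵥ a) i : ℂ) * ((Uᵀ *ᵥ b) i : ℂ) * (z - κ i)⁻¹ := by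
  rw [h.eqR, ← mulVec_mulVec, ← mulVec_mulVec, ← cv_mulVec, dotProduct_mulVec,
    ← mulVec_transpose, ← transpose_map, ← cv_mulVec]
  simp only [dotProduct, mulVec_diagonal, cv]
  refine Finset.sum_congr rfl fun i _ => ?_
  ring

lemma bil2 (h : RD K z U κ) (a b : Fin n → ℝ) : cv a ⬝ᵥ (Rz K z *ᵥ (Rz K z *ᵥ cv b))
    = ∑ i, ((Uᵀ *ᵥ a) i : ℂ) * ((Uᵀ *ᵥ b) i : ℂ) * ((z - κ i)⁻¹) ^ 2 := by
  have h2c : Uᵀ.map Complex.ofReal * U.map Complex.ofReal = 1 := by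
    have := congrArg (fun M : Matrix (Fin n) (Fin n) ℝ => M.map Complex.ofRealHom) h.UU'
    simp only [Matrix.map_mul] at this
    rw [Matrix.map_one _ (by simp) (by simp)] at this
    exact this
  have : Rz K z * Rz K z = U.map Complex.ofReal * (diagonal (fun i => (z - κ i)⁻¹) * diagonal (fun i => (z - κ i)⁻¹)) * Uᵀ.map Complex.ofReal := by
    rw [h.eqR]
    calc _ = U.map Complex.ofReal * diagonal (fun i => (z - κ i)⁻¹) * (Uᵀ.map Complex.ofReal *
          U.map Complex.ofReal) * diagonal (fun i => (z - (κ i : ℂ))⁻¹) * Uᵀ.map Complex.ofReal := by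
            simp only [Matrix.mul_assoc]
      _ = _ := by rw [h2c, mul_one]; simp only [Matrix.mul_assoc]
  rw [mulVec_mulVec, this, diagonal_mul_diagonal, ← mulVec_mulVec, ← mulVec_mulVec, ← cv_mulVec, dotProduct_mulVec,
    ← mulVec_transpose, ← transpose_map, ← cv_mulVec]
  simp only [dotProduct, mulVec_diagonal, cv]
  refine Finset.sum_congr rfl fun i _ => ?_
  ring

lemma qf_eq (h : RD K z U κ) (a : Fin n → ℝ) : qf (Rz K z) a
    = ∑ i, (((Uᵀ *ᵥ a) i ^ 2 : ℝ) : ℂ) * (z - κ i)⁻¹ := by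
  rw [qf, h.bil]
  refine Finset.sum_congr rfl fun i _ => ?_
  push_cast; ring

lemma im_inv (z : ℂ) (x : ℝ) : ((z - x)⁻¹).im = - z.im * ‖(z - x)⁻¹‖ ^ 2 := by
  rw [Complex.inv_im, norm_inv, inv_pow, Complex.normSq_eq_norm_sq]
  simp [div_eq_mul_inv]

lemma im_qf (h : RD K z U κ) (a : Fin n → ℝ) : (qf (Rz K z) a).im
    = - z.im * ∑ i, (Uᵀ *ᵥ a) i ^ 2 * ‖(z - κ i)⁻¹‖ ^ 2 := by
  rw [h.qf_eq, Complex.im_sum, Finset.mul_sum]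
  refine Finset.sum_congr rfl fun i _ => ?_
  rw [Complex.im_ofReal_mul, im_inv]
  ring

lemma norm_U (h : RD K z U κ) (a : Fin n → ℝ) : ∑ i, (Uᵀ *ᵥ a) i ^ 2 = a ⬝ᵥ a := by
  have e : ∀ a : Fin n → ℝ, ∑ i, a i ^ 2 = a ⬝ᵥ a := by
    intro a; simp [dotProduct, sq]
  rw [e, dotProduct_mulVec, ← mulVec_transpose, transpose_transpose, mulVec_mulVec, h.UU, one_mulVec]

end RD

lemma im_trace_nonpos {n : ℕ} {K : Matrix (Fin n) (Fin n) ℝ} (hK : K.PosSemidef) {z : ℂ} (hz : 0 < z.im) :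
    (Rz K z).trace.im ≤ 0 := by
  obtain ⟨U, κ, h⟩ := exists_RD hK hz
  rw [h.trace, Complex.im_sum]
  refine Finset.sum_nonpos fun i _ => ?_
  rw [RD.im_inv]
  have := sq_nonneg ‖(z - κ i)⁻¹‖
  nlinarith

lemma bil_bound {n : ℕ} {K : Matrix (Fin n) (Fin n) ℝ} (hK : K.PosSemidef) {z : ℂ} (hz : 0 < z.im)
    (a b : Fin n → ℝ) :
    ‖cv a ⬝ᵥ (Rz K z *ᵥ cv b)‖ ^ 2 * z.im ≤ (a ⬝ᵥ a) * (-(qf (Rz K z) b).im) := by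
  obtain ⟨U, κ, h⟩ := exists_RD hK hz
  rw [h.im_qf, h.bil, ← h.norm_U a]
  have h1 : ‖∑ i, ((Uᵀ *ᵥ a) i : ℂ) * ((Uᵀ *ᵥ b) i : ℂ) * (z - κ i)⁻¹‖
      ≤ ∑ i, |(Uᵀ *ᵥ a) i| * (|(Uᵀ *ᵥ b) i| * ‖(z - κ i)⁻¹‖) := by
    refine (norm_sum_le _ _).trans (Finset.sum_le_sum fun i _ => ?_)
    simp [mul_assoc]
  have h2 := Finset.sum_mul_sq_le_sq_mul_sq Finset.univ (fun i => |(Uᵀ *ᵥ a) i|) (fun i => |(Uᵀ *ᵥ b) i| * ‖(z - κ i)⁻¹‖)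
  simp only [sq_abs, mul_pow] at h2
  have h3 := pow_le_pow_left₀ (norm_nonneg _) h1 2
  have h4 := h3.trans h2
  nlinarith

lemma qf2_bound {n : ℕ} {K : Matrix (Fin n) (Fin n) ℝ} (hK : K.PosSemidef) {z : ℂ} (hz : 0 < z.im)
    (b : Fin n → ℝ) :
    ‖cv b ⬝ᵥ (Rz K z *ᵥ (Rz K z *ᵥ cv b))‖ * z.im ≤ -(qf (Rz K z) b).im := by
  obtain ⟨U, κ, h⟩ := exists_RD hK hz
  rw [h.im_qf, h.bil2]
  have h1 : ‖∑ i, ((Uᵀ *ᵥ b) i : ℂ) * ((Uᵀ *ᵥ b) i : ℂ) * ((z - κ i)⁻¹) ^ 2‖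
      ≤ ∑ i, (Uᵀ *ᵥ b) i ^ 2 * ‖(z - κ i)⁻¹‖ ^ 2 := by
    refine (norm_sum_le _ _).trans (Finset.sum_le_sum fun i _ => ?_)
    rw [norm_mul, norm_mul, norm_pow, ← sq, Complex.norm_real, Real.norm_eq_abs, sq_abs]
  nlinarith

lemma one_sub_qf {n : ℕ} {K : Matrix (Fin n) (Fin n) ℝ} (hK : K.PosSemidef) {z : ℂ} (hz : 0 < z.im)
    (b : Fin n → ℝ) : z.im ≤ ‖z‖ * ‖1 - qf (Rz K z) b‖ := by
  obtain ⟨U, κ, h⟩ := exists_RD hK hz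
  rw [← norm_mul]
  refine le_trans ?_ (Complex.abs_im_le_norm _)
  refine le_trans ?_ (le_abs_self _)
  have : z * (1 - qf (Rz K z) b) = z - ∑ i, (((Uᵀ *ᵥ b) i ^ 2 : ℝ) : ℂ) * (1 + κ i * (z - κ i)⁻¹) := by
    rw [mul_sub, mul_one, h.qf_eq, Finset.mul_sum]
    congr 1
    refine Finset.sum_congr rfl fun i _ => ?_
    have := z_sub_ne hz (κ i)
    field_simp
    ring
  rw [this, Complex.sub_im, Complex.im_sum]
  have : ∑ i, ((((Uᵀ *ᵥ b) i ^ 2 : ℝ) : ℂ) * (1 + κ i * (z - κ i)⁻¹)).im ≤ 0 := by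
    refine Finset.sum_nonpos fun i _ => ?_
    rw [Complex.im_ofReal_mul, Complex.add_im, Complex.im_ofReal_mul, RD.im_inv]
    have h1 := sq_nonneg ‖(z - κ i)⁻¹‖
    have h2 := sq_nonneg ((Uᵀ *ᵥ b) i)
    have h3 := h.nn i
    have h4 : 0 ≤ κ i * z.im * ‖(z - κ i)⁻¹‖ ^ 2 := by positivity
    simp only [Complex.one_im, zero_add]
    nlinarith
  linarith


lemma quad_gauss {n : ℕ} {K : Matrix (Fin n) (Fin n) ℝ} (hK : K.PosSemidef) {z : ℂ} (hz : 0 < z.im)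
    (v : ℝ≥0) :
    ∫⁻ w : Fin n → ℝ, ENNReal.ofReal (‖qf (Rz K z) w - (v : ℂ) * (Rz K z).trace‖ ^ 2)
      ∂(Measure.pi fun _ : Fin n => gaussianReal 0 v)
      ≤ ENNReal.ofReal ((v : ℝ) ^ 2 * gC * (n / z.im ^ 2)) := by
  obtain ⟨U, κ, h⟩ := exists_RD hK hz
  set d : Fin n → ℂ := fun i => (z - κ i)⁻¹ with hd
  have h1 : ∀ w : Fin n → ℝ, ‖qf (Rz K z) w - (v : ℂ) * (Rz K z).trace‖ ^ 2
      = (∑ i, (d i).re * ((Uᵀ *ᵥ w) i ^ 2 - v)) ^ 2 + (∑ i, (d i).im * ((Uᵀ *ᵥ w) i ^ 2 - v)) ^ 2 := by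
    intro w
    have : qf (Rz K z) w - (v : ℂ) * (Rz K z).trace = ∑ i, (((Uᵀ *ᵥ w) i ^ 2 - v : ℝ) : ℂ) * d i := by
      rw [h.qf_eq, h.trace, Finset.mul_sum, ← Finset.sum_sub_distrib]
      refine Finset.sum_congr rfl fun i _ => ?_
      rw [hd]; push_cast; ring
    rw [this, ← Complex.normSq_eq_norm_sq, Complex.normSq_apply, Complex.re_sum, Complex.im_sum, ← sq, ← sq]
    simp_rw [Complex.re_ofReal_mul, Complex.im_ofReal_mul, mul_comm]
  simp_rw [h1]
  have hrot := rot_pi v Uᵀ (by rw [transpose_transpose]; exact h.UU')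
  rw [hrot.lintegral_comp (f := fun ξ => ENNReal.ofReal ((∑ i, (d i).re * (ξ i ^ 2 - v)) ^ 2 + (∑ i, (d i).im * (ξ i ^ 2 - v)) ^ 2)) (by fun_prop)]
  have hr := diag_real v (fun i => (d i).re)
  have hi := diag_real v (fun i => (d i).im)
  have hsum := ofReal_integral_eq_lintegral_ofReal (hr.1.add hi.1)
    (Filter.Eventually.of_forall fun w => add_nonneg (sq_nonneg _) (sq_nonneg _))
  refine hsum.symm.le.trans ?_
  apply ENNReal.ofReal_le_ofReal
  rw [integral_add' hr.1 hi.1, hr.2, hi.2, ← mul_add, ← Finset.sum_add_distrib]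
  have hg := gC_nonneg
  gcongr
  have : ∀ i ∈ Finset.univ, (d i).re ^ 2 + (d i).im ^ 2 ≤ (z.im ^ 2)⁻¹ := by
    intro i _
    have h2 : (d i).re ^ 2 + (d i).im ^ 2 = ‖d i‖ ^ 2 := by
      rw [← Complex.normSq_eq_norm_sq, Complex.normSq_apply]; ring
    rw [h2, hd, norm_inv, inv_pow]
    gcongr
    have := Complex.abs_im_le_norm (z - κ i)
    simp only [Complex.sub_im, Complex.ofReal_im, sub_zero] at this
    exact (le_abs_self _).trans this
  refine (Finset.sum_le_sum this).trans ?_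
  simp [div_eq_mul_inv]

lemma norm_gauss {n : ℕ} (v : ℝ≥0) :
    ∫⁻ w : Fin n → ℝ, ENNReal.ofReal ((w ⬝ᵥ w - n * v) ^ 2)
      ∂(Measure.pi fun _ : Fin n => gaussianReal 0 v)
      ≤ ENNReal.ofReal ((v : ℝ) ^ 2 * gC * n) := by
  have hr := diag_real (n := n) v (fun i => 1)
  have : ∀ w : Fin n → ℝ, w ⬝ᵥ w - n * v = ∑ i, 1 * (w i ^ 2 - (v : ℝ)) := by
    intro w; simp [dotProduct, sq]
  simp_rw [this]
  rw [← ofReal_integral_eq_lintegral_ofReal hr.1 (Filter.Eventually.of_forall fun w => by positivity), hr.2]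
  simp

def KS {n p : ℕ} (C : Fin p → Fin n → ℝ) (s : Finset (Fin p)) : Matrix (Fin n) (Fin n) ℝ :=
  ∑ k ∈ s, vecMulVec (C k) (C k)

lemma KS_psd {n p : ℕ} (C : Fin p → Fin n → ℝ) (s : Finset (Fin p)) : (KS C s).PosSemidef := by
  refine posSemidef_sum _ fun k _ => ?_
  simpa using posSemidef_vecMulVec_self_star (C k)

lemma KS_erase {n p : ℕ} (C : Fin p → Fin n → ℝ) (j : Fin p) :
    KS C Finset.univ = KS C (Finset.univ.erase j) + vecMulVec (C j) (C j) := by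
  rw [KS, KS, Finset.sum_erase_add _ _ (Finset.mem_univ j)]

section sm
variable {n : ℕ} {K : Matrix (Fin n) (Fin n) ℝ} {z : ℂ} (c : Fin n → ℝ)

lemma map_vmv : (vecMulVec c c).map Complex.ofReal = vecMulVec (cv c) (cv c) := by
  ext i j; simp [vecMulVec, cv]

lemma psd_add (hK : K.PosSemidef) : (K + vecMulVec c c).PosSemidef :=
  hK.add (by simpa using posSemidef_vecMulVec_self_star c)

lemma sm_eq (hK : K.PosSemidef) (hz : 0 < z.im) :
    Rz (K + vecMulVec c c) z = Rz K z + Rz (K + vecMulVec c c) z * vecMulVec (cv c) (cv c) * Rz K z := by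
  obtain ⟨U, κ, h⟩ := exists_RD hK hz
  obtain ⟨U', κ', h'⟩ := exists_RD (psd_add c hK) hz
  have h1 := h'.mul_left
  have h2 : (K + vecMulVec c c).map Complex.ofReal = K.map Complex.ofReal + vecMulVec (cv c) (cv c) := by
    rw [← map_vmv]; ext; simp
  rw [h2, ← sub_sub, mul_sub] at h1
  have h3 := congrArg (fun M => M * Rz K z) h1
  simp only [sub_mul, one_mul] at h3
  rw [Matrix.mul_assoc, h.mul_right, mul_one] at h3
  exact (sub_eq_iff_eq_add.mp h3)

lemma sm_vec (hK : K.PosSemidef) (hz : 0 < z.im) :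
    (1 - qf (Rz K z) c) • (Rz (K + vecMulVec c c) z *ᵥ cv c) = Rz K z *ᵥ cv c := by
  have h := congrArg (fun M => M *ᵥ cv c) (sm_eq c hK hz)
  simp only [add_mulVec, ← mulVec_mulVec] at h
  rw [vecMulVec_mulVec] at h
  have : cv c ⬝ᵥ Rz K z *ᵥ cv c = qf (Rz K z) c := rfl
  rw [this] at h
  simp only [op_smul_eq_smul, mulVec_smul] at h
  rw [sub_smul, one_smul]
  nth_rewrite 1 [h]
  abel

lemma sm_qf (hK : K.PosSemidef) (hz : 0 < z.im) :
    (1 - qf (Rz K z) c) * (1 + qf (Rz (K + vecMulVec c c) z) c) = 1 := by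
  have h := congrArg (fun x => cv c ⬝ᵥ x) (sm_vec c hK hz)
  simp only [dotProduct_smul, smul_eq_mul] at h
  have h1 : cv c ⬝ᵥ Rz K z *ᵥ cv c = qf (Rz K z) c := rfl
  have h2 : cv c ⬝ᵥ Rz (K + vecMulVec c c) z *ᵥ cv c = qf (Rz (K + vecMulVec c c) z) c := rfl
  rw [h1, h2] at h
  rw [mul_add, h]; ring

lemma sm_ne (hK : K.PosSemidef) (hz : 0 < z.im) : 1 - qf (Rz K z) c ≠ 0 := by
  intro h0
  have := one_sub_qf hK hz c
  rw [h0] at this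
  simp at this
  linarith

lemma sm_trace (hK : K.PosSemidef) (hz : 0 < z.im) :
    ‖(Rz (K + vecMulVec c c) z).trace - (Rz K z).trace‖ ≤ 1 / z.im := by
  have h := congrArg Matrix.trace (sm_eq c hK hz)
  rw [trace_add, Matrix.mul_assoc, Matrix.trace_mul_comm, Matrix.mul_assoc, trace_mul_comm, Matrix.mul_assoc,
    mul_vecMulVec, mul_vecMulVec, trace_vecMulVec, dotProduct_comm] at h
  have h1 : (1 - qf (Rz K z) c) * ((Rz (K + vecMulVec c c) z).trace - (Rz K z).trace)
      = cv c ⬝ᵥ (Rz K z *ᵥ (Rz K z *ᵥ cv c)) := by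
    rw [← sm_vec c hK hz, mulVec_smul, dotProduct_smul, smul_eq_mul, h]
    ring
  have h2 := qf2_bound hK hz c
  rw [← h1, norm_mul] at h2
  have h3 : -(qf (Rz K z) c).im ≤ ‖1 - qf (Rz K z) c‖ := by
    refine le_trans ?_ (Complex.abs_im_le_norm _)
    refine le_trans ?_ (le_abs_self _)
    simp
  have h4 : 0 < ‖1 - qf (Rz K z) c‖ := norm_pos_iff.mpr (sm_ne c hK hz)
  rw [le_div_iff₀ hz]
  have h5 := h2.trans h3
  by_contra hcon
  push Not at hcon
  nlinarith
end sm

/-- leave-one-out quadratic form -/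
def qj {n p : ℕ} (z : ℂ) (C : Fin p → Fin n → ℝ) (j : Fin p) : ℂ :=
  qf (Rz (KS C (Finset.univ.erase j)) z) (C j)
def gj {n p : ℕ} (z : ℂ) (C : Fin p → Fin n → ℝ) (j : Fin p) : ℂ :=
  ((n : ℝ≥0)⁻¹ : ℝ≥0) * (Rz (KS C (Finset.univ.erase j)) z).trace
def gg {n p : ℕ} (z : ℂ) (C : Fin p → Fin n → ℝ) : ℂ :=
  ((n : ℝ≥0)⁻¹ : ℝ≥0) * (Rz (KS C Finset.univ) z).trace
def QQ {n p : ℕ} (z : ℂ) (C : Fin p → Fin n → ℝ) : ℝ := ∑ j, ‖qj z C j - gj z C j‖ ^ 2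

lemma gg_gj {n p : ℕ} {z : ℂ} (hz : 0 < z.im) (C : Fin p → Fin n → ℝ) (j : Fin p) :
    ‖gj z C j - gg z C‖ ≤ 1 / (n * z.im) := by
  have h := sm_trace (C j) (KS_psd C (Finset.univ.erase j)) hz
  rw [← KS_erase] at h
  rw [gj, gg, ← mul_sub, norm_mul, norm_sub_rev]
  have : ‖((((n : ℝ≥0)⁻¹ : ℝ≥0) : ℝ) : ℂ)‖ = (n : ℝ)⁻¹ := by
    rw [Complex.norm_real]; simp
  rw [this]
  calc _ ≤ (n : ℝ)⁻¹ * (1 / z.im) := by gcongr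
    _ = _ := by rw [one_div, one_div, mul_inv]

lemma tr_id {n p : ℕ} {z : ℂ} (hz : 0 < z.im) (C : Fin p → Fin n → ℝ) :
    z * (Rz (KS C Finset.univ) z).trace - n = ∑ j, qf (Rz (KS C Finset.univ) z) (C j) := by
  obtain ⟨U, κ, h⟩ := exists_RD (KS_psd C Finset.univ) hz
  have h1 := congrArg Matrix.trace h.mul_right
  rw [sub_mul, trace_sub, smul_mul_assoc, one_mul, trace_smul, trace_one, Fintype.card_fin, smul_eq_mul] at h1
  have h2 : (KS C Finset.univ).map Complex.ofReal = ∑ j, vecMulVec (cv (C j)) (cv (C j)) := by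
    ext a b
    simp [KS, Matrix.sum_apply, vecMulVec, cv]
  rw [sub_eq_iff_eq_add] at h1
  rw [h1, add_sub_cancel_left]
  nth_rewrite 1 [h2]
  rw [Finset.sum_mul, trace_sum]
  refine Finset.sum_congr rfl fun j _ => ?_
  rw [trace_mul_comm, mul_vecMulVec, trace_vecMulVec, dotProduct_comm]
  rfl

lemma mp_id {n p : ℕ} (hn : 0 < n) {z : ℂ} (hz : 0 < z.im) (C : Fin p → Fin n → ℝ) :
    (1 - gg z C) * ((p : ℂ) / n + z * gg z C - 1) - (p : ℂ) / n
      = (n : ℂ)⁻¹ * ∑ j, (qj z C j - gg z C) * (1 - qj z C j)⁻¹ := by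
  have hn' : (n : ℂ) ≠ 0 := by exact_mod_cast hn.ne'
  have h1 := tr_id hz C
  have h2 : (Rz (KS C Finset.univ) z).trace = n * gg z C := by
    rw [gg]; push_cast; field_simp
  have h3 : ∀ j, qf (Rz (KS C Finset.univ) z) (C j) = (1 - qj z C j)⁻¹ - 1 := by
    intro j
    have := sm_qf (C j) (KS_psd C (Finset.univ.erase j)) hz
    rw [← KS_erase] at this
    have := eq_inv_of_mul_eq_one_right this
    rw [qj, ← this]; ring
  have h4 : ∀ j, (qj z C j - gg z C) * (1 - qj z C j)⁻¹ = (1 - gg z C) * (1 - qj z C j)⁻¹ - 1 := by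
    intro j
    have : 1 - qj z C j ≠ 0 := sm_ne (C j) (KS_psd C (Finset.univ.erase j)) hz
    field_simp
    ring
  simp_rw [h4]
  simp_rw [h3, h2] at h1
  rw [Finset.sum_sub_distrib] at h1 ⊢
  rw [← Finset.mul_sum]
  simp only [Finset.sum_const, Finset.card_univ, Fintype.card_fin, nsmul_eq_mul, mul_one] at h1 ⊢
  rw [eq_sub_iff_add_eq] at h1
  rw [← h1]
  field_simp
  ring

lemma mp_bound {n p : ℕ} (hn : 0 < n) {z : ℂ} (hz : 0 < z.im) (C : Fin p → Fin n → ℝ) {t : ℝ}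
    (ht : QQ z C ≤ n * t) :
    ‖(1 - gg z C) * ((p : ℂ) / n + z * gg z C - 1) - (p : ℂ) / n‖
      ≤ ‖z‖ / z.im * (Real.sqrt ((p : ℝ) / n * t) + (p : ℝ) / n * (1 / (n * z.im))) := by
  have hn' : (0 : ℝ) < n := by exact_mod_cast hn
  rw [mp_id hn hz, norm_mul, norm_inv, Complex.norm_natCast]
  have hterm : ∀ j, ‖(qj z C j - gg z C) * (1 - qj z C j)⁻¹‖ ≤
      (‖qj z C j - gj z C j‖ + 1 / (n * z.im)) * (‖z‖ / z.im) := by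
    intro j
    rw [norm_mul]
    gcongr
    · calc ‖qj z C j - gg z C‖ = ‖(qj z C j - gj z C j) + (gj z C j - gg z C)‖ := by congr 1; ring
        _ ≤ _ := (norm_add_le _ _).trans (by gcongr; exact gg_gj hz C j)
    · have h1 := one_sub_qf (KS_psd C (Finset.univ.erase j)) hz (C j)
      have h2 : 0 < ‖1 - qj z C j‖ := norm_pos_iff.mpr (sm_ne (C j) (KS_psd C (Finset.univ.erase j)) hz)
      rw [norm_inv, inv_le_comm₀ h2 (by
        have : z ≠ 0 := by rintro rfl; simp at hz
        positivity), inv_div, div_le_iff₀ (by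
        have : z ≠ 0 := by rintro rfl; simp at hz
        positivity), mul_comm]
      exact h1
  have hS : ∑ j, ‖qj z C j - gj z C j‖ ≤ n * Real.sqrt ((p : ℝ) / n * t) := by
    have h1 := sq_sum_le_card_mul_sum_sq (s := Finset.univ) (f := fun j => ‖qj z C j - gj z C j‖)
    rw [Finset.card_univ, Fintype.card_fin] at h1
    have h2 : (∑ j, ‖qj z C j - gj z C j‖) ^ 2 ≤ n ^ 2 * ((p : ℝ) / n * t) := by
      refine h1.trans ?_
      have : (p : ℝ) * QQ z C ≤ p * (n * t) := by gcongr
      refine this.trans (le_of_eq ?_)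
      field_simp
    have h3 := Real.sqrt_le_sqrt h2
    rwa [Real.sqrt_sq (by positivity), Real.sqrt_mul (by positivity), Real.sqrt_sq hn'.le] at h3
  calc _ ≤ (n : ℝ)⁻¹ * ∑ j : Fin p, (‖qj z C j - gj z C j‖ + 1 / (n * z.im)) * (‖z‖ / z.im) := by
        gcongr
        exact (norm_sum_le _ _).trans (Finset.sum_le_sum fun j _ => hterm j)
    _ = (n : ℝ)⁻¹ * (‖z‖ / z.im) * (∑ j : Fin p, ‖qj z C j - gj z C j‖ + p * (1 / (n * z.im))) := by
        rw [← Finset.sum_mul, Finset.sum_add_distrib]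
        simp
        ring
    _ ≤ (n : ℝ)⁻¹ * (‖z‖ / z.im) * (n * Real.sqrt ((p : ℝ) / n * t) + p * (1 / (n * z.im))) := by
        gcongr
    _ = _ := by field_simp


def nu (n p : ℕ) : Measure (Fin p → Fin n → ℝ) :=
  Measure.pi fun _ : Fin p => Measure.pi fun _ : Fin n => gaussianReal 0 (n : ℝ≥0)⁻¹

lemma cont_Rz {n p : ℕ} {z : ℂ} (hz : 0 < z.im) (s : Finset (Fin p)) :
    Continuous fun C : Fin p → Fin n → ℝ => Rz (KS C s) z := by
  have hA : Continuous fun C : Fin p → Fin n → ℝ =>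
      (z • (1 : Matrix (Fin n) (Fin n) ℂ) - (KS C s).map Complex.ofReal) := by
    refine continuous_const.sub ?_
    refine Continuous.matrix_map ?_ Complex.continuous_ofReal
    unfold KS
    refine continuous_finsetSum _ fun k _ => ?_
    exact Continuous.matrix_vecMulVec (continuous_apply k) (continuous_apply k)
  have hdet : ∀ C : Fin p → Fin n → ℝ,
      (z • (1 : Matrix (Fin n) (Fin n) ℂ) - (KS C s).map Complex.ofReal).det ≠ 0 := by
    intro C
    obtain ⟨U, κ, h⟩ := exists_RD (KS_psd C s) hz
    have := congrArg Matrix.det h.mul_left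
    rw [det_mul, det_one] at this
    exact right_ne_zero_of_mul_eq_one this
  unfold Rz
  simp_rw [Matrix.inv_def, Ring.inverse_eq_inv']
  exact (hA.matrix_det.inv₀ hdet).smul hA.matrix_adjugate

lemma cont_cv {n : ℕ} : Continuous (cv (n := n)) := by
  unfold cv; fun_prop

lemma cont_qj {n p : ℕ} {z : ℂ} (hz : 0 < z.im) (j : Fin p) :
    Continuous fun C : Fin p → Fin n → ℝ => qj z C j := by
  unfold qj qf
  have h : Continuous fun C : Fin p → Fin n → ℝ => cv (C j) := cont_cv.comp (continuous_apply j)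
  exact h.dotProduct ((cont_Rz hz _).matrix_mulVec h)

lemma cont_gj {n p : ℕ} {z : ℂ} (hz : 0 < z.im) (j : Fin p) :
    Continuous fun C : Fin p → Fin n → ℝ => gj z C j := by
  unfold gj
  exact continuous_const.mul (cont_Rz hz _).matrix_trace

instance {n p : ℕ} : IsProbabilityMeasure (nu n p) := by unfold nu; infer_instance

lemma KS_update {n p : ℕ} (C : Fin p → Fin n → ℝ) (j : Fin p) (w : Fin n → ℝ) :
    KS (Function.update C j w) (Finset.univ.erase j) = KS C (Finset.univ.erase j) := by
  unfold KS
  refine Finset.sum_congr rfl fun k hk => ?_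
  rw [Function.update_of_ne (Finset.ne_of_mem_erase hk)]

lemma lint_le {n p : ℕ} (j : Fin p) {f : (Fin p → Fin n → ℝ) → ℝ≥0∞} (hf : Measurable f) (B : ℝ≥0∞)
    (h : ∀ C, ∫⁻ w, f (Function.update C j w) ∂(Measure.pi fun _ : Fin n => gaussianReal 0 (n : ℝ≥0)⁻¹) ≤ B) :
    ∫⁻ C, f C ∂(nu n p) ≤ B := by
  have := lintegral_le_of_lmarginal_le (μ := fun _ : Fin p => Measure.pi fun _ : Fin n => gaussianReal 0 (n : ℝ≥0)⁻¹)
    {j} (f := f) (g := fun _ => B) hf measurable_const (by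
      intro C
      rw [lmarginal_singleton, lmarginal_singleton]
      simpa using h C)
  refine this.trans ?_
  simp

lemma lint_qj {n p : ℕ} (hn : 0 < n) {z : ℂ} (hz : 0 < z.im) (j : Fin p) :
    ∫⁻ C, ENNReal.ofReal (‖qj z C j - gj z C j‖ ^ 2) ∂(nu n p) ≤ ENNReal.ofReal (gC / z.im ^ 2 / n) := by
  have hn' : (0 : ℝ) < n := by exact_mod_cast hn
  refine lint_le j ?_ _ ?_
  · have h1 := cont_qj (n := n) hz j
    have h2 := cont_gj (n := n) hz j
    exact (ENNReal.continuous_ofReal.comp ((h1.sub h2).norm.pow 2)).measurable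
  · intro C
    unfold qj gj
    simp_rw [KS_update, Function.update_self]
    refine (quad_gauss (KS_psd C _) hz _).trans (ENNReal.ofReal_le_ofReal (le_of_eq ?_))
    push_cast
    field_simp

lemma prob_qj {n p : ℕ} (hn : 0 < n) {z : ℂ} (hz : 0 < z.im) (j : Fin p) {t : ℝ} (ht : 0 < t) :
    nu n p {C | t ≤ ‖qj z C j - gj z C j‖ ^ 2} ≤ ENNReal.ofReal (gC / z.im ^ 2 / t * (1 / n)) := by
  have h := lint_qj (p := p) hn hz j
  have h2 := meas_ge_le_lintegral_div (μ := nu n p) (f := fun C => ENNReal.ofReal (‖qj z C j - gj z C j‖ ^ 2))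
    (by
      have h1 := cont_qj (n := n) hz j
      have h2 := cont_gj (n := n) hz j
      exact (ENNReal.continuous_ofReal.comp ((h1.sub h2).norm.pow 2)).measurable.aemeasurable)
    (ε := ENNReal.ofReal t) (by simpa using ht) (by simp)
  refine le_trans (measure_mono ?_) (h2.trans ?_)
  · intro C hC
    exact ENNReal.ofReal_le_ofReal hC
  · refine (ENNReal.div_le_div_right h _).trans ?_
    rw [← ENNReal.ofReal_div_of_pos ht]
    apply ENNReal.ofReal_le_ofReal
    apply le_of_eq; field_simp

lemma prob_QQ {n p : ℕ} (hn : 0 < n) {z : ℂ} (hz : 0 < z.im) {t : ℝ} (ht : 0 < t) :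
    nu n p {C | n * t ≤ QQ z C} ≤ ENNReal.ofReal (gC / z.im ^ 2 / t * ((p : ℝ) / n) * (1 / n)) := by
  have hn' : (0 : ℝ) < n := by exact_mod_cast hn
  have hm : ∀ j : Fin p, Measurable fun C : Fin p → Fin n → ℝ => ENNReal.ofReal (‖qj z C j - gj z C j‖ ^ 2) := by
    intro j
    have h1 := cont_qj (n := n) hz j
    have h2 := cont_gj (n := n) hz j
    exact (ENNReal.continuous_ofReal.comp ((h1.sub h2).norm.pow 2)).measurable
  have he : ∀ C : Fin p → Fin n → ℝ, ENNReal.ofReal (QQ z C) = ∑ j, ENNReal.ofReal (‖qj z C j - gj z C j‖ ^ 2) := by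
    intro C
    rw [QQ, ENNReal.ofReal_sum_of_nonneg (fun _ _ => by positivity)]
  have h : ∫⁻ C, ENNReal.ofReal (QQ z C) ∂(nu n p) ≤ ENNReal.ofReal (p * (gC / z.im ^ 2 / n)) := by
    simp_rw [he]
    rw [lintegral_finsetSum _ (fun j _ => hm j)]
    refine (Finset.sum_le_sum fun j _ => lint_qj hn hz j).trans ?_
    rw [Finset.sum_const, Finset.card_univ, Fintype.card_fin, nsmul_eq_mul, ENNReal.ofReal_mul (by positivity)]
    simp
  have h2 := meas_ge_le_lintegral_div (μ := nu n p) (f := fun C => ENNReal.ofReal (QQ z C))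
    (by
      simp_rw [he]
      exact (Finset.measurable_fun_sum _ fun j _ => hm j).aemeasurable)
    (ε := ENNReal.ofReal (n * t)) (by rw [ne_eq, ENNReal.ofReal_eq_zero, not_le]; positivity) ENNReal.ofReal_ne_top
  refine le_trans (measure_mono ?_) (h2.trans ?_)
  · intro C hC
    exact ENNReal.ofReal_le_ofReal hC
  · refine (ENNReal.div_le_div_right h _).trans ?_
    rw [← ENNReal.ofReal_div_of_pos (by positivity)]
    apply ENNReal.ofReal_le_ofReal
    apply le_of_eq; field_simp

lemma prob_norm {n p : ℕ} (hn : 0 < n) (j : Fin p) :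
    nu n p {C | 1 / 4 ≤ (C j ⬝ᵥ C j - 1) ^ 2} ≤ ENNReal.ofReal (4 * gC * (1 / n)) := by
  have hn' : (0 : ℝ) < n := by exact_mod_cast hn
  have hm : Measurable fun C : Fin p → Fin n → ℝ => ENNReal.ofReal ((C j ⬝ᵥ C j - 1) ^ 2) := by
    have : Continuous fun C : Fin p → Fin n → ℝ => (C j ⬝ᵥ C j - 1) ^ 2 := by
      simp only [dotProduct]; fun_prop
    exact (ENNReal.continuous_ofReal.comp this).measurable
  have h : ∫⁻ C, ENNReal.ofReal ((C j ⬝ᵥ C j - 1) ^ 2) ∂(nu n p) ≤ ENNReal.ofReal (gC / n) := by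
    refine lint_le j hm _ ?_
    intro C
    simp_rw [Function.update_self]
    have := norm_gauss (n := n) ((n : ℝ≥0)⁻¹)
    have e : (n : ℝ) * (((n : ℝ≥0)⁻¹ : ℝ≥0) : ℝ) = 1 := by push_cast; field_simp
    simp_rw [e] at this
    refine this.trans (ENNReal.ofReal_le_ofReal (le_of_eq ?_))
    push_cast
    field_simp
  have h2 := meas_ge_le_lintegral_div (μ := nu n p) (f := fun C => ENNReal.ofReal ((C j ⬝ᵥ C j - 1) ^ 2))
    hm.aemeasurable (ε := ENNReal.ofReal (1 / 4)) (by simp) (by simp)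
  refine le_trans (measure_mono ?_) (h2.trans ?_)
  · intro C hC
    exact ENNReal.ofReal_le_ofReal hC
  · refine (ENNReal.div_le_div_right h _).trans ?_
    rw [← ENNReal.ofReal_div_of_pos (by norm_num)]
    apply ENNReal.ofReal_le_ofReal
    apply le_of_eq; field_simp


lemma exists_orth {p : ℕ} (v : Fin p → ℝ) (hv : v ⬝ᵥ v = 1) :
    ∃ (j0 : Fin p) (O : Matrix (Fin p) (Fin p) ℝ), Oᵀ * O = 1 ∧ O * Oᵀ = 1 ∧ ∀ j, O j j0 = v j := by
  have hne : Nonempty (Fin p) := by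
    by_contra h
    rw [not_nonempty_iff] at h
    simp [dotProduct] at hv
  obtain ⟨j0⟩ := hne
  refine ⟨j0, ?_⟩
  obtain ⟨b, hb⟩ := Orthonormal.exists_orthonormalBasis_extension_of_card_eq (𝕜 := ℝ)
    (E := EuclideanSpace ℝ (Fin p)) (ι := Fin p) (by simp) (v := fun _ => WithLp.toLp 2 v) (s := {j0}) (by
      constructor
      · intro i
        simp only [Set.restrict_apply]
        rw [EuclideanSpace.norm_eq]
        simp only [Real.norm_eq_abs, sq_abs]
        rw [Real.sqrt_eq_one, ← hv]
        simp [dotProduct, sq]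
      · intro i j hij
        exact absurd (Subsingleton.elim i j) hij)
  have h1 : (Matrix.of fun j k => b k j)ᵀ * (Matrix.of fun j k => b k j) = (1 : Matrix (Fin p) (Fin p) ℝ) := by
    ext k l
    have := orthonormal_iff_ite.mp b.orthonormal k l
    rw [Matrix.one_apply, ← this, Matrix.mul_apply]
    simp [PiLp.inner_apply, mul_comm]
  refine ⟨Matrix.of fun j k => b k j, h1, mul_eq_one_comm.mp h1, ?_⟩
  intro j
  have := hb j0 rfl
  simp [this]

def Cmap {n p : ℕ} (lam : ℝ) (v : Fin p → ℝ) (O : Matrix (Fin p) (Fin p) ℝ) (s : Fin p → ℝ)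
    (uZ : (Fin n → ℝ) × (Fin n → Fin p → ℝ)) : Fin p → Fin n → ℝ :=
  fun k i => (s k)⁻¹ * ∑ j, O j k * (lam * uZ.1 i * v j + uZ.2 i j)

lemma Cmap_cont {n p : ℕ} (lam : ℝ) (v : Fin p → ℝ) (O : Matrix (Fin p) (Fin p) ℝ) (s : Fin p → ℝ) :
    Continuous (Cmap (n := n) lam v O s) := by
  unfold Cmap; fun_prop

lemma Cmap_law {n p : ℕ} (lam : ℝ) (v : Fin p → ℝ) (O : Matrix (Fin p) (Fin p) ℝ) (s : Fin p → ℝ)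
    (j0 : Fin p) (hO : Oᵀ * O = 1) (hv : ∀ j, O j j0 = v j) (hs0 : s j0 ^ 2 = 1 + lam ^ 2)
    (hs : ∀ k, k ≠ j0 → s k ^ 2 = 1) :
    (spikedLaw n p).map (Cmap lam v O s) = nu n p := by
  have : IsProbabilityMeasure (spikedLaw n p) := by unfold spikedLaw; infer_instance
  have hm := (Cmap_cont (n := n) lam v O s).measurable
  have : IsProbabilityMeasure ((spikedLaw n p).map (Cmap lam v O s)) := Measure.isProbabilityMeasure_map hm.aemeasurable
  have hOO : ∀ k l, ∑ j, O j k * O j l = if k = l then 1 else 0 := by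
    intro k l
    have := congrFun (congrFun hO k) l
    rw [Matrix.mul_apply, Matrix.one_apply] at this
    exact this
  apply Measure.ext_of_charFunDual
  ext L
  rw [charFunDual_apply, charFunDual_apply, integral_map hm.aemeasurable (by fun_prop)]
  obtain ⟨T, hL⟩ : ∃ T : Fin p → Fin n → ℝ, ∀ x : Fin p → Fin n → ℝ, L x = ∑ k, ∑ i, T k i * x k i := by
    refine ⟨fun k i => L (Pi.single k (Pi.single i 1)), fun x => ?_⟩
    conv_lhs => rw [← Finset.univ_sum_single x]
    rw [map_sum]
    refine Finset.sum_congr rfl fun k _ => ?_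
    conv_lhs => rw [← Finset.univ_sum_single (x k)]
    have : (Pi.single k (∑ i, Pi.single i (x k i)) : Fin p → Fin n → ℝ) = ∑ i, x k i • Pi.single k (Pi.single i 1) := by
      ext k' i'
      by_cases h : k' = k
      · subst h
        simp [Finset.sum_apply, Pi.single_apply]
      · simp [h]
    rw [this, map_sum]
    refine Finset.sum_congr rfl fun i _ => ?_
    rw [map_smul, smul_eq_mul, mul_comm]
  simp_rw [hL]
  have hr := cf_pi_pi (n : ℝ≥0)⁻¹ T
  unfold nu
  rw [hr]
  set b : Fin n → Fin p → ℝ := fun i j => ∑ k, (s k)⁻¹ * O j k * T k i with hb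
  set a : Fin n → ℝ := fun i => lam * (s j0)⁻¹ * T j0 i with ha
  have hlin : ∀ uZ : (Fin n → ℝ) × (Fin n → Fin p → ℝ), ∑ k, ∑ i, T k i * Cmap lam v O s uZ k i
      = ∑ i, a i * uZ.1 i + ∑ i, ∑ j, b i j * uZ.2 i j := by
    intro uZ
    rw [Finset.sum_comm, ← Finset.sum_add_distrib]
    refine Finset.sum_congr rfl fun i _ => ?_
    have h1 : ∀ k, T k i * Cmap lam v O s uZ k i =
        (if k = j0 then lam * (s k)⁻¹ * T k i * uZ.1 i else 0) + ∑ j, (s k)⁻¹ * O j k * T k i * uZ.2 i j := by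
      intro k
      have h2 := hOO k j0
      simp_rw [hv] at h2
      have h3 : (if k = j0 then lam * (s k)⁻¹ * T k i * uZ.1 i else 0) = lam * (s k)⁻¹ * T k i * uZ.1 i * ∑ j, O j k * v j := by
        rw [h2]; split_ifs <;> simp
      rw [h3, Finset.mul_sum, ← Finset.sum_add_distrib]
      unfold Cmap
      rw [Finset.mul_sum, Finset.mul_sum]
      refine Finset.sum_congr rfl fun j _ => ?_
      ring
    simp_rw [h1]
    rw [Finset.sum_add_distrib]
    congr 1
    · simp [ha]
    · rw [Finset.sum_comm]
      simp_rw [hb, Finset.sum_mul]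
  simp_rw [hlin]
  have hsq : ∑ i, a i ^ 2 + ∑ i, ∑ j, b i j ^ 2 = ∑ k, ∑ i, T k i ^ 2 := by
    rw [Finset.sum_comm (f := fun k i => T k i ^ 2), ← Finset.sum_add_distrib]
    refine Finset.sum_congr rfl fun i _ => ?_
    have h1 : ∑ j, b i j ^ 2 = ∑ k, ((s k)⁻¹ * T k i) ^ 2 := by
      have : ∀ j, b i j ^ 2 = ∑ k, ∑ l, ((s k)⁻¹ * T k i) * ((s l)⁻¹ * T l i) * (O j k * O j l) := by
        intro j
        rw [sq, hb, Finset.sum_mul_sum]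
        refine Finset.sum_congr rfl fun k _ => Finset.sum_congr rfl fun l _ => by ring
      simp_rw [this]
      rw [Finset.sum_comm]
      refine Finset.sum_congr rfl fun k _ => ?_
      rw [Finset.sum_comm]
      simp_rw [← Finset.mul_sum, hOO]
      simp [sq]
    rw [h1]
    have h2 : a i ^ 2 = ∑ k, if k = j0 then a i ^ 2 else 0 := by simp
    rw [h2, ← Finset.sum_add_distrib]
    refine Finset.sum_congr rfl fun k _ => ?_
    split_ifs with hk
    · subst hk
      simp only [ha]
      rw [mul_pow, mul_pow, mul_pow, inv_pow, hs0]
      have : (1 + lam ^ 2) ≠ 0 := by positivity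
      field_simp
      ring
    · rw [mul_pow, inv_pow, hs k hk]; simp
  unfold spikedLaw
  have hsplit : ∀ uZ : (Fin n → ℝ) × (Fin n → Fin p → ℝ),
      Complex.exp (((∑ i, a i * uZ.1 i + ∑ i, ∑ j, b i j * uZ.2 i j : ℝ) : ℂ) * Complex.I)
      = Complex.exp (((∑ i, a i * uZ.1 i : ℝ) : ℂ) * Complex.I) * Complex.exp (((∑ i, ∑ j, b i j * uZ.2 i j : ℝ) : ℂ) * Complex.I) := by
    intro uZ
    rw [← Complex.exp_add, ← add_mul, Complex.ofReal_add]
  simp_rw [hsplit]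
  rw [integral_prod_mul (fun u : Fin n → ℝ => Complex.exp (((∑ i, a i * u i : ℝ) : ℂ) * Complex.I))
    (fun Z : Fin n → Fin p → ℝ => Complex.exp (((∑ i, ∑ j, b i j * Z i j : ℝ) : ℂ) * Complex.I)),
    cf_pi, cf_pi_pi, ← Complex.exp_add, ← hsq]
  congr 1
  push_cast
  ring


lemma dot_cs {n : ℕ} (a b : Fin n → ℝ) : (a ⬝ᵥ b) ^ 2 ≤ (a ⬝ᵥ a) * (b ⬝ᵥ b) := by
  have := Finset.sum_mul_sq_le_sq_mul_sq Finset.univ a b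
  simpa [dotProduct, sq] using this

lemma dot_self_nn {n : ℕ} (a : Fin n → ℝ) : 0 ≤ a ⬝ᵥ a :=
  Finset.sum_nonneg fun _ _ => mul_self_nonneg _

lemma adj_dot {n p : ℕ} (X : Matrix (Fin n) (Fin p) ℝ) (v w : Fin p → ℝ) :
    (X *ᵥ v) ⬝ᵥ (X *ᵥ w) = v ⬝ᵥ ((Xᵀ * X) *ᵥ w) := by
  rw [← Matrix.mulVec_mulVec, Matrix.dotProduct_mulVec v, Matrix.vecMul_transpose]

lemma top_rayleigh {p : ℕ} (S : Matrix (Fin p) (Fin p) ℝ) (hS : S.PosSemidef) (c : ℝ)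
    (htop : ∀ c' : ℝ, ∀ w : Fin p → ℝ, w ≠ 0 → S.mulVec w = c' • w → c' ≤ c) (w : Fin p → ℝ) :
    w ⬝ᵥ (S *ᵥ w) ≤ c * (w ⬝ᵥ w) := by
  obtain ⟨U, κ, h1, h2, h3, h4⟩ := psd_diag hS
  have hκ : ∀ i, κ i ≤ c := by
    intro i
    refine htop (κ i) (U *ᵥ Pi.single i 1) ?_ ?_
    · intro h
      have := congrArg (fun x => Uᵀ *ᵥ x) h
      simp only [Matrix.mulVec_mulVec, h2, Matrix.one_mulVec, Matrix.mulVec_zero] at this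
      have := congrFun this i
      simp at this
    · rw [h4, Matrix.mulVec_mulVec, Matrix.mul_assoc, h2, Matrix.mul_one, ← Matrix.mulVec_mulVec]
      rw [← Matrix.mulVec_smul]
      congr 1
      ext k
      rw [Matrix.mulVec_diagonal]
      by_cases hk : k = i
      · subst hk; simp
      · simp [hk]
  have e1 : w ⬝ᵥ (S *ᵥ w) = ∑ i, κ i * (Uᵀ *ᵥ w) i ^ 2 := by
    rw [h4, ← Matrix.mulVec_mulVec, ← Matrix.mulVec_mulVec, Matrix.dotProduct_mulVec, ← Matrix.mulVec_transpose]
    simp only [dotProduct, Matrix.mulVec_diagonal]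
    refine Finset.sum_congr rfl fun i _ => by ring
  have e2 : w ⬝ᵥ w = ∑ i, (Uᵀ *ᵥ w) i ^ 2 := by
    have : (Uᵀ *ᵥ w) ⬝ᵥ (Uᵀ *ᵥ w) = w ⬝ᵥ w := by
      rw [adj_dot, Matrix.transpose_transpose, h1, Matrix.one_mulVec]
    rw [← this]
    simp [dotProduct, sq]
  rw [e1, e2, Finset.mul_sum]
  exact Finset.sum_le_sum fun i _ => mul_le_mul_of_nonneg_right (hκ i) (sq_nonneg _)

lemma res_bound {n : ℕ} {K : Matrix (Fin n) (Fin n) ℝ} (hK : K.PosSemidef) {z : ℂ} (hz : 0 < z.im)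
    (y q : Fin n → ℝ) (c a : ℝ) (hc : 0 < c) (hq : q ⬝ᵥ q = c) (hyq : y ⬝ᵥ q = c * a)
    (he : K *ᵥ q + (y ⬝ᵥ q) • y = c • q) :
    c * a ^ 2 * z.im * ‖1 - qf (Rz K z) y‖ ≤ ‖z - c‖ ^ 2 := by
  obtain ⟨U, κ, h⟩ := exists_RD hK hz
  set B := cv q ⬝ᵥ (Rz K z *ᵥ cv y) with hB
  have hKs : Kᵀ = K := by
    have := hK.1; rwa [Matrix.IsHermitian, Matrix.conjTranspose_eq_transpose_of_trivial] at this
  have hKq : K.map Complex.ofReal *ᵥ cv q = (c : ℂ) • cv q - ((c * a : ℝ) : ℂ) • cv y := by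
    rw [← cv_mulVec, eq_sub_of_add_eq he, hyq]
    ext i; simp [cv]
  have key : ((c * a : ℝ) : ℂ) * (1 - qf (Rz K z) y) = (z - c) * B := by
    have h1 : cv q ⬝ᵥ (((z • 1 - K.map Complex.ofReal) * Rz K z) *ᵥ cv y) = ((c * a : ℝ) : ℂ) := by
      rw [h.mul_right, Matrix.one_mulVec, cv_dot, dotProduct_comm, hyq]
    have h2 : cv q ⬝ᵥ ((K.map Complex.ofReal) *ᵥ (Rz K z *ᵥ cv y)) = c * B - ((c * a : ℝ) : ℂ) * qf (Rz K z) y := by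
      rw [Matrix.dotProduct_mulVec, ← Matrix.mulVec_transpose, ← Matrix.transpose_map, hKs, hKq,
        sub_dotProduct, smul_dotProduct, smul_dotProduct]
      rfl
    rw [← Matrix.mulVec_mulVec, Matrix.sub_mulVec, Matrix.smul_mulVec, Matrix.one_mulVec, dotProduct_sub,
      dotProduct_smul, h2] at h1
    rw [smul_eq_mul] at h1
    linear_combination -h1
  have hb := bil_bound hK hz q y
  rw [hq] at hb
  have him : -(qf (Rz K z) y).im ≤ ‖1 - qf (Rz K z) y‖ := by
    have := Complex.abs_im_le_norm (1 - qf (Rz K z) y)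
    simp only [Complex.sub_im, Complex.one_im, zero_sub] at this
    exact (le_abs_self _).trans this
  have hk := congrArg (fun w => ‖w‖ ^ 2) key
  simp only [norm_mul, mul_pow, Complex.norm_real, Real.norm_eq_abs, sq_abs] at hk
  set w := ‖1 - qf (Rz K z) y‖
  have hw : 0 ≤ w := norm_nonneg _
  rcases hw.eq_or_lt with h0 | h0
  · rw [← h0]; simp
  · have h5 : c * a ^ 2 * z.im * w * (c * w) ≤ ‖z - c‖ ^ 2 * (c * w) := by
      calc c * a ^ 2 * z.im * w * (c * w) = ‖z - c‖ ^ 2 * (‖B‖ ^ 2 * z.im) := by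
            linear_combination z.im * hk
        _ ≤ ‖z - c‖ ^ 2 * (c * -(qf (Rz K z) y).im) := by gcongr
        _ ≤ _ := by gcongr
    exact le_of_mul_le_mul_right h5 (by positivity)

lemma endgame (lam δ : ℝ) (hl : 0 < lam) (hd : lam ^ 4 < δ) : ∃ ρ > 0, ∃ B > 0, ∀ (d : ℝ) (g z : ℂ),
    |d - δ| ≤ ρ → ‖g - 1 / (1 + (lam : ℂ) ^ 2)‖ ≤ ρ → g.im ≤ 0 →
    z.im ≤ B * ‖(1 - g) * (d + z * g - 1) - d‖ := by
  set g0 : ℂ := 1 / (1 + (lam : ℂ) ^ 2) with hg0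
  have hθ : (0 : ℝ) < 1 + lam ^ 2 := by positivity
  have hgr : g0 = ((1 / (1 + lam ^ 2) : ℝ) : ℂ) := by rw [hg0]; push_cast; rfl
  have hgr' : 1 - g0 = ((lam ^ 2 / (1 + lam ^ 2) : ℝ) : ℂ) := by
    rw [hgr, ← Complex.ofReal_one, ← Complex.ofReal_sub]; congr 1; field_simp; ring
  have n1 : ‖g0‖ = 1 / (1 + lam ^ 2) := by
    rw [hgr, Complex.norm_real, Real.norm_eq_abs, abs_of_pos (by positivity)]
  have n2 : ‖1 - g0‖ = lam ^ 2 / (1 + lam ^ 2) := by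
    rw [hgr', Complex.norm_real, Real.norm_eq_abs, abs_of_pos (by positivity)]
  have c1 : ∀ᶠ x : ℝ × ℂ in nhds (δ, g0), ‖1 - x.2‖ ^ 2 < x.1 * ‖x.2‖ ^ 2 := by
    have : Continuous fun x : ℝ × ℂ => x.1 * ‖x.2‖ ^ 2 - ‖1 - x.2‖ ^ 2 := by fun_prop
    have h := this.continuousAt (x := (δ, g0)) |>.eventually (lt_mem_nhds (a := 0) (by
      simp only [n1, n2]
      have : δ * (1 / (1 + lam ^ 2)) ^ 2 - (lam ^ 2 / (1 + lam ^ 2)) ^ 2 = (δ - lam ^ 4) / (1 + lam ^ 2) ^ 2 := by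
        field_simp
      rw [this]
      have : 0 < δ - lam ^ 4 := by linarith
      positivity))
    filter_upwards [h] with x hx
    linarith
  set m := ‖g0‖ * ‖1 - g0‖ / 2 with hm
  have hmp : 0 < m := by rw [hm, n1, n2]; positivity
  have c2 : ∀ᶠ x : ℝ × ℂ in nhds (δ, g0), m < ‖x.2‖ * ‖1 - x.2‖ := by
    have : Continuous fun x : ℝ × ℂ => ‖x.2‖ * ‖1 - x.2‖ := by fun_prop
    exact this.continuousAt (x := (δ, g0)) |>.eventually (lt_mem_nhds (a := m) (by simp only; linarith))
  obtain ⟨r, hr, hball⟩ := Metric.eventually_nhds_iff.mp (c1.and c2)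
  refine ⟨r / 2, by positivity, 1 / m, by positivity, ?_⟩
  intro d g z hd1 hg1 hgi
  obtain ⟨h1, h2⟩ := hball (y := (d, g)) (by
    rw [Prod.dist_eq, max_lt_iff, Real.dist_eq, dist_eq_norm]
    exact ⟨by linarith, by linarith⟩)
  simp only at h1 h2
  set e := (1 - g) * (d + z * g - 1) - d with he
  have hg : g ≠ 0 := by rintro rfl; simp at h2; linarith
  have hg' : 1 - g ≠ 0 := by intro h; rw [h] at h2; simp at h2; linarith
  have hz : z = g⁻¹ + d * (1 - g)⁻¹ + e / (g * (1 - g)) := by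
    rw [he]; field_simp; ring
  have him : z.im = g.im * (d / ‖1 - g‖ ^ 2 - 1 / ‖g‖ ^ 2) + (e / (g * (1 - g))).im := by
    conv_lhs => rw [hz]
    simp only [Complex.add_im, Complex.inv_im, Complex.im_ofReal_mul, Complex.normSq_eq_norm_sq,
      Complex.sub_im, Complex.one_im]
    ring
  have p1 : 0 < ‖g‖ := norm_pos_iff.mpr hg
  have p2 : 0 < ‖1 - g‖ := norm_pos_iff.mpr hg'
  have hbr : 0 ≤ d / ‖1 - g‖ ^ 2 - 1 / ‖g‖ ^ 2 := by
    rw [sub_nonneg, div_le_div_iff₀ (by positivity) (by positivity)]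
    linarith
  have h3 : (e / (g * (1 - g))).im ≤ 1 / m * ‖e‖ := by
    refine (le_abs_self _).trans ((Complex.abs_im_le_norm _).trans ?_)
    rw [norm_div, norm_mul, div_eq_mul_one_div, mul_comm]
    gcongr
  nlinarith [mul_nonneg (neg_nonneg.mpr hgi) hbr]


lemma model_facts {n p : ℕ} (lam : ℝ) (v : Fin p → ℝ) (O : Matrix (Fin p) (Fin p) ℝ) (s : Fin p → ℝ)
    (j0 : Fin p) (hO : O * Oᵀ = 1) (hv : ∀ j, O j j0 = v j) (hs0 : s j0 ≠ 0)
    (hs : ∀ k, k ≠ j0 → s k = 1) (uZ : (Fin n → ℝ) × (Fin n → Fin p → ℝ)) :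
    spikedMatrix lam v uZ.1 uZ.2 *ᵥ v = s j0 • Cmap lam v O s uZ j0 ∧
    spikedMatrix lam v uZ.1 uZ.2 * (spikedMatrix lam v uZ.1 uZ.2)ᵀ =
      vecMulVec (s j0 • Cmap lam v O s uZ j0) (s j0 • Cmap lam v O s uZ j0)
        + KS (Cmap lam v O s uZ) (Finset.univ.erase j0) := by
  set X := spikedMatrix lam v uZ.1 uZ.2 with hX
  set C := Cmap lam v O s uZ with hC
  have hsk : ∀ k, s k ≠ 0 := by
    intro k
    by_cases h : k = j0
    · rw [h]; exact hs0
    · rw [hs k h]; exact one_ne_zero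
  have hXO : ∀ i k, (X * O) i k = s k * C k i := by
    intro i k
    rw [hC, Cmap, ← mul_assoc, mul_inv_cancel₀ (hsk k), one_mul, Matrix.mul_apply]
    refine Finset.sum_congr rfl fun j _ => ?_
    rw [hX, spikedMatrix, Matrix.of_apply, mul_comm]
  constructor
  · ext i
    have := hXO i j0
    rw [Matrix.mul_apply] at this
    simp_rw [hv] at this
    simpa [mulVec, dotProduct] using this
  · have h1 : X * Xᵀ = (X * O) * (X * O)ᵀ := by
      rw [Matrix.transpose_mul, Matrix.mul_assoc, ← Matrix.mul_assoc O, hO, Matrix.one_mul]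
    rw [h1]
    ext i i'
    rw [Matrix.mul_apply, Matrix.add_apply, KS, Matrix.sum_apply, ← Finset.add_sum_erase _ _ (Finset.mem_univ j0)]
    congr 1
    · simp [hXO, vecMulVec_apply]
    · refine Finset.sum_congr rfl fun k hk => ?_
      simp [hXO, vecMulVec_apply, hs k (Finset.ne_of_mem_erase hk)]

lemma core1 {n p : ℕ} (lam : ℝ) (v : Fin p → ℝ) (O : Matrix (Fin p) (Fin p) ℝ) (s : Fin p → ℝ)
    (j0 : Fin p) (hO : O * Oᵀ = 1) (hv : ∀ j, O j j0 = v j) (hv1 : v ⬝ᵥ v = 1) (hs0 : s j0 ^ 2 = 1 + lam ^ 2)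
    (hs : ∀ k, k ≠ j0 → s k = 1) (uZ : (Fin n → ℝ) × (Fin n → Fin p → ℝ)) (w : Fin p → ℝ)
    (hw : IsTopUnitEigenvector ((spikedMatrix lam v uZ.1 uZ.2)ᵀ * spikedMatrix lam v uZ.1 uZ.2) w)
    (ε : ℝ) (hε : 0 < ε) (hwv : ε < |dotp w v|)
    (hC : (Cmap lam v O s uZ j0 ⬝ᵥ Cmap lam v O s uZ j0 - 1) ^ 2 < 1 / 4) :
    ∃ c : ℝ, 1 / 2 ≤ c ∧ c ≤ 3 * (1 + lam ^ 2) / (2 * ε ^ 2) ∧ ∀ z : ℂ, 0 < z.im →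
      c * ε ^ 2 * z.im * ‖1 - (1 + (lam : ℂ) ^ 2) * qj z (Cmap lam v O s uZ) j0‖ ≤ ‖z - c‖ ^ 2 := by
  have hs0' : s j0 ≠ 0 := by
    intro h; rw [h] at hs0; nlinarith [sq_nonneg lam]
  obtain ⟨m1, m2⟩ := model_facts lam v O s j0 hO hv hs0' hs uZ
  set X := spikedMatrix lam v uZ.1 uZ.2 with hX
  set C := Cmap lam v O s uZ with hCdef
  obtain ⟨w1, c, w2, w3⟩ := hw
  set a := dotp w v with ha
  have ha' : v ⬝ᵥ w = a := by rw [dotProduct_comm]; rfl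
  have hw1 : w ⬝ᵥ w = 1 := w1
  set y := s j0 • C j0 with hy
  set q := X *ᵥ w with hq
  have hyy : y ⬝ᵥ y = (1 + lam ^ 2) * (C j0 ⬝ᵥ C j0) := by
    rw [hy, smul_dotProduct, dotProduct_smul, smul_eq_mul, smul_eq_mul, ← hs0]; ring
  have hqq : q ⬝ᵥ q = c := by
    rw [hq, adj_dot, w2, dotProduct_smul, hw1]; simp
  have hyq : y ⬝ᵥ q = c * a := by
    rw [← m1, hq, adj_dot, w2, dotProduct_smul, ha']; simp
  have hab := abs_lt.mp (abs_lt_of_sq_lt_sq (show (C j0 ⬝ᵥ C j0 - 1) ^ 2 < (1 / 2) ^ 2 by linarith) (by norm_num))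
  have hS : (Xᵀ * X).PosSemidef := by
    have := Matrix.posSemidef_conjTranspose_mul_self X
    rwa [Matrix.conjTranspose_eq_transpose_of_trivial] at this
  have hc1 : y ⬝ᵥ y ≤ c := by
    have := top_rayleigh _ hS c w3 v
    rwa [← adj_dot, m1, hv1, mul_one] at this
  have hl := sq_nonneg lam
  have hc2 : 1 / 2 ≤ c := by nlinarith
  have hc0 : 0 < c := by linarith
  have hcs := dot_cs y q
  rw [hyq, hqq] at hcs
  have hca : c * a ^ 2 ≤ y ⬝ᵥ y := by
    refine le_of_mul_le_mul_right ?_ hc0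
    linarith
  have haε : ε ^ 2 ≤ a ^ 2 := by
    rw [← sq_abs a]; gcongr
  have hc3 : c * ε ^ 2 ≤ 3 / 2 * (1 + lam ^ 2) := by
    have : c * ε ^ 2 ≤ c * a ^ 2 := by gcongr
    nlinarith
  refine ⟨c, hc2, ?_, ?_⟩
  · rw [le_div_iff₀ (by positivity)]; linarith
  · intro z hz
    have he : KS C (Finset.univ.erase j0) *ᵥ q + (y ⬝ᵥ q) • y = c • q := by
      have : (X * Xᵀ) *ᵥ q = c • q := by
        rw [hq, Matrix.mulVec_mulVec, Matrix.mul_assoc, ← Matrix.mulVec_mulVec, w2, Matrix.mulVec_smul]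
      rw [← this, m2, Matrix.add_mulVec, Matrix.vecMulVec_mulVec, add_comm]
      simp
    have hr := res_bound (KS_psd C _) hz y q c a hc0 hqq hyq he
    have hQ : qf (Rz (KS C (Finset.univ.erase j0)) z) y = (1 + (lam : ℂ) ^ 2) * qj z C j0 := by
      have : cv y = ((s j0 : ℝ) : ℂ) • cv (C j0) := by ext i; simp [cv, hy]
      have h2 : (1 + (lam : ℂ) ^ 2) = ((s j0 : ℝ) : ℂ) ^ 2 := by
        rw [← Complex.ofReal_pow (s j0), hs0]; push_cast; rfl
      rw [qj, qf, qf, this, Matrix.mulVec_smul, smul_dotProduct, dotProduct_smul, h2, smul_eq_mul, smul_eq_mul]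
      ring
    rw [hQ] at hr
    refine le_trans ?_ hr
    gcongr


def zk (η : ℝ) (k : ℕ) : ℂ := ⟨k * η, η⟩

lemma core2 (lam δ ε : ℝ) (hl : 0 < lam) (hd : lam ^ 4 < δ) (hε : 0 < ε) :
    ∃ η > 0, ∃ N : ℕ, ∃ t > 0, ∃ ρ > 0, ∃ κ > 0, ∀ (n p : ℕ), 0 < n → |(p : ℝ) / n - δ| ≤ ρ → 1 / (n : ℝ) ≤ κ →
      ∀ (C : Fin p → Fin n → ℝ) (j0 : Fin p) (c : ℝ), 1 / 2 ≤ c → c ≤ 3 * (1 + lam ^ 2) / (2 * ε ^ 2) →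
      (∀ z : ℂ, 0 < z.im → c * ε ^ 2 * z.im * ‖1 - (1 + (lam : ℂ) ^ 2) * qj z C j0‖ ≤ ‖z - c‖ ^ 2) →
      (∀ k ∈ Finset.range (N + 1), ‖qj (zk η k) C j0 - gj (zk η k) C j0‖ ^ 2 < t ∧ QQ (zk η k) C < n * t) → False := by
  obtain ⟨ρ, hρ, B, hB, hend⟩ := endgame lam δ hl hd
  set cm := 3 * (1 + lam ^ 2) / (2 * ε ^ 2) with hcm
  set η := ρ * ε ^ 2 / 16 with hη
  have hηp : 0 < η := by positivity
  have hcmp : 0 < cm := by positivity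
  set M := cm + η with hM
  have hMp : 0 < M := by positivity
  set D := δ + ρ with hD
  have hDp : 0 < D := by have : 0 < lam ^ 4 := by positivity
                         linarith
  set r := η ^ 2 / (4 * B * M) with hr
  have hrp : 0 < r := by positivity
  set t := min ((ρ / 4) ^ 2) (r ^ 2 / D) with ht
  have htp : 0 < t := by positivity
  set κ := min (ρ / 4 * η) (r / D * η) with hκ
  have hκp : 0 < κ := by positivity
  refine ⟨η, hηp, ⌊cm / η⌋₊, t, htp, ρ, hρ, κ, hκp, ?_⟩
  intro n p hn hpn hnk C j0 c hc1 hc2 hcz hgood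
  have hn' : (0 : ℝ) < n := by exact_mod_cast hn
  set k := ⌊c / η⌋₊ with hk
  set z := zk η k with hz
  have hzi : z.im = η := rfl
  have hzr : z.re = k * η := rfl
  have hzp : 0 < z.im := hηp
  have hkN : k ∈ Finset.range (⌊cm / η⌋₊ + 1) := by
    rw [Finset.mem_range, Nat.lt_succ_iff]
    exact Nat.floor_le_floor (by gcongr)
  obtain ⟨g1, g2⟩ := hgood k hkN
  have hk1 : k * η ≤ c := by
    have := Nat.floor_le (show 0 ≤ c / η by positivity)
    rwa [le_div_iff₀ hηp] at this
  have hk2 : c < k * η + η := by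
    have := Nat.lt_floor_add_one (c / η)
    rw [div_lt_iff₀ hηp] at this
    linarith
  have hzc : ‖z - c‖ ^ 2 ≤ 2 * η ^ 2 := by
    rw [← Complex.normSq_eq_norm_sq, Complex.normSq_apply]
    simp only [Complex.sub_re, Complex.sub_im, Complex.ofReal_re, Complex.ofReal_im, hzr, hzi]
    nlinarith
  have hzM : ‖z‖ ≤ M := by
    refine (Complex.norm_le_abs_re_add_abs_im z).trans ?_
    rw [hzr, hzi, abs_of_nonneg (by positivity), abs_of_pos hηp]
    linarith
  have h1 := (hcz z hzp).trans hzc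
  rw [hzi] at h1
  set θ : ℂ := 1 + (lam : ℂ) ^ 2 with hθ
  have hθr : θ = ((1 + lam ^ 2 : ℝ) : ℂ) := by rw [hθ]; push_cast; rfl
  have hθn : ‖θ‖ = 1 + lam ^ 2 := by
    rw [hθr, Complex.norm_real, Real.norm_eq_abs, abs_of_pos (by positivity)]
  have hθ0 : θ ≠ 0 := by
    rw [← norm_ne_zero_iff, hθn]; positivity
  have h2 : ‖1 - θ * qj z C j0‖ ≤ ρ / 4 := by
    have a1 : (1 / 2) * ε ^ 2 * η * ‖1 - θ * qj z C j0‖ ≤ c * ε ^ 2 * η * ‖1 - θ * qj z C j0‖ := by gcongr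
    have a2 : (1 / 2) * ε ^ 2 * η * ‖1 - θ * qj z C j0‖ ≤ (1 / 2) * ε ^ 2 * η * (ρ / 4) := by
      refine (a1.trans h1).trans (le_of_eq ?_)
      rw [hη]; ring
    exact le_of_mul_le_mul_left a2 (by positivity)
  have h3 : ‖qj z C j0 - 1 / θ‖ ≤ ρ / 4 := by
    have : qj z C j0 - 1 / θ = -((1 - θ * qj z C j0) / θ) := by field_simp; ring
    rw [this, norm_neg, norm_div, hθn]
    refine (div_le_self (norm_nonneg _) ?_).trans h2
    nlinarith [sq_nonneg lam]
  have h4 : ‖qj z C j0 - gj z C j0‖ ≤ ρ / 4 :=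
    (abs_le_of_sq_le_sq' (a := ‖qj z C j0 - gj z C j0‖) (g1.le.trans (min_le_left _ _)) (by positivity)).2
  have h5 : 1 / (n * z.im) ≤ ρ / 4 := by
    rw [hzi, one_div, mul_inv, ← one_div, ← div_eq_mul_inv, div_le_iff₀ hηp]
    exact hnk.trans (min_le_left _ _)
  have h5' : 1 / (n * z.im) ≤ r / D := by
    rw [hzi, one_div, mul_inv, ← one_div, ← div_eq_mul_inv, div_le_iff₀ hηp]
    exact hnk.trans (min_le_right _ _)
  have h6 := gg_gj hzp C j0
  have hg : ‖gg z C - 1 / θ‖ ≤ ρ := by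
    have e : gg z C - 1 / θ = (qj z C j0 - 1 / θ) - (qj z C j0 - gj z C j0) - (gj z C j0 - gg z C) := by ring
    rw [e]
    refine (norm_sub_le _ _).trans ?_
    have := norm_sub_le (qj z C j0 - 1 / θ) (qj z C j0 - gj z C j0)
    linarith
  have hgi : (gg z C).im ≤ 0 := by
    have := im_trace_nonpos (KS_psd C Finset.univ) hzp
    rw [gg]
    have e : (((n : ℝ≥0)⁻¹ : ℝ≥0) : ℂ) = (((n : ℝ)⁻¹ : ℝ) : ℂ) := by push_cast; rfl
    rw [e, Complex.im_ofReal_mul]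
    exact mul_nonpos_of_nonneg_of_nonpos (by positivity) this
  have hfin := hend ((p : ℝ) / n) (gg z C) z hpn hg hgi
  have hmp := mp_bound hn hzp C g2.le
  have ec : (((p : ℝ) / n : ℝ) : ℂ) = (p : ℂ) / n := by push_cast; rfl
  rw [ec, hzi] at hfin
  have hd' : (p : ℝ) / n ≤ D := by have := (abs_le.mp hpn).2; linarith
  have hd0 : 0 ≤ (p : ℝ) / n := by positivity
  have b1 : Real.sqrt ((p : ℝ) / n * t) ≤ r := by
    apply Real.sqrt_le_iff.mpr
    refine ⟨hrp.le, ?_⟩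
    calc (p : ℝ) / n * t ≤ D * (r ^ 2 / D) := by
          gcongr
          exact min_le_right _ _
      _ = r ^ 2 := by field_simp
  have b2 : (p : ℝ) / n * (1 / (n * z.im)) ≤ r := by
    calc (p : ℝ) / n * (1 / (n * z.im)) ≤ D * (r / D) := by gcongr
      _ = r := by field_simp
  have b3 : ‖z‖ / z.im * (Real.sqrt ((p : ℝ) / n * t) + (p : ℝ) / n * (1 / (n * z.im))) ≤ M / η * (r + r) := by
    rw [hzi] at b2 ⊢
    gcongr
  have b4 : B * (M / η * (r + r)) = η / 2 := by
    rw [hr]; field_simp; ring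
  have b5 := mul_le_mul_of_nonneg_left (hmp.trans b3) hB.le
  linarith

/-- **Subcritical spiked model (BBP).** If `p/n → δ ≥ 0` and the fixed signal strength `λ`
satisfies `λ < δ^{1/4}`, then the inner product between the top unit eigenvector `v̂`
of `XᵀX` and the spike direction `v*` converges in probability to `0`. -/
theorem spiked_pca_subcritical
    (δ : ℝ) (hδ : 0 ≤ δ) (lam : ℝ) (hlam0 : 0 < lam) (hlam : lam < δ ^ ((1 : ℝ) / 4))
    (p : ℕ → ℕ)
    (hp : Tendsto (fun n : ℕ => (p n : ℝ) / (n : ℝ)) atTop (nhds δ))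
    (vstar : ∀ n : ℕ, Fin (p n) → ℝ)
    (hvstar : ∀ n, dotp (vstar n) (vstar n) = 1)
    (vhat : ∀ n : ℕ, (Fin n → ℝ) → (Fin n → Fin (p n) → ℝ) → (Fin (p n) → ℝ))
    (hvhat_meas : ∀ n, Measurable fun uZ : (Fin n → ℝ) × (Fin n → Fin (p n) → ℝ) =>
      vhat n uZ.1 uZ.2)
    (hvhat : ∀ n u Z, IsTopUnitEigenvector
      ((spikedMatrix lam (vstar n) u Z)ᵀ * spikedMatrix lam (vstar n) u Z) (vhat n u Z)) :
    ∀ ε > (0 : ℝ), Tendsto (fun n : ℕ =>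
      spikedLaw n (p n) {uZ | ε <
        |dotp (vhat n uZ.1 uZ.2) (vstar n)|})
      atTop (nhds 0) := by
  intro ε hε
  have hd : lam ^ 4 < δ := by
    have h1 : lam ^ 4 < (δ ^ ((1 : ℝ) / 4)) ^ 4 := by gcongr
    rwa [← Real.rpow_natCast, ← Real.rpow_natCast, ← Real.rpow_mul hδ, show ((1 : ℝ) / 4 * ((4 : ℕ) : ℝ)) = 1 by norm_num,
      Real.rpow_one, Real.rpow_natCast] at h1
  obtain ⟨η, hη, N, t, ht, ρ, hρ, κ, hκ, hcore⟩ := core2 lam δ ε hlam0 hd hε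
  set bd : ℕ → ℝ≥0∞ := fun n => ENNReal.ofReal (4 * gC * (1 / n)) + ∑ _k ∈ Finset.range (N + 1),
    (ENNReal.ofReal (gC / η ^ 2 / t * (1 / n)) + ENNReal.ofReal (gC / η ^ 2 / t * ((p n : ℝ) / n) * (1 / n))) with hbd
  have hlim1 : Tendsto (fun n : ℕ => 1 / (n : ℝ)) atTop (nhds 0) := tendsto_one_div_atTop_nhds_zero_nat
  have hbd0 : Tendsto bd atTop (nhds 0) := by
    have t1 : Tendsto (fun n : ℕ => ENNReal.ofReal (4 * gC * (1 / (n : ℝ)))) atTop (nhds 0) := by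
      have := ENNReal.tendsto_ofReal (hlim1.const_mul (4 * gC))
      simpa using this
    have t2 : Tendsto (fun n : ℕ => ENNReal.ofReal (gC / η ^ 2 / t * (1 / (n : ℝ)))) atTop (nhds 0) := by
      have := ENNReal.tendsto_ofReal (hlim1.const_mul (gC / η ^ 2 / t))
      simpa using this
    have t3 : Tendsto (fun n : ℕ => ENNReal.ofReal (gC / η ^ 2 / t * ((p n : ℝ) / n) * (1 / (n : ℝ)))) atTop (nhds 0) := by
      have := ENNReal.tendsto_ofReal ((hp.const_mul (gC / η ^ 2 / t)).mul hlim1)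
      simpa using this
    have := t1.add (tendsto_finsetSum (Finset.range (N + 1)) fun _ _ => t2.add t3)
    simpa [hbd] using this
  refine tendsto_of_tendsto_of_tendsto_of_le_of_le' tendsto_const_nhds hbd0 (Eventually.of_forall fun _ => zero_le) ?_
  have ev1 : ∀ᶠ n : ℕ in atTop, |(p n : ℝ) / n - δ| ≤ ρ := by
    have := Metric.tendsto_nhds.mp hp ρ hρ
    filter_upwards [this] with n hn
    rw [Real.dist_eq] at hn
    exact hn.le
  have ev2 : ∀ᶠ n : ℕ in atTop, 1 / (n : ℝ) ≤ κ := (hlim1.eventually (gt_mem_nhds hκ)).mono fun _ h => h.le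
  filter_upwards [ev1, ev2, eventually_gt_atTop 0] with n e1 e2 hn
  have hv1 : vstar n ⬝ᵥ vstar n = 1 := hvstar n
  obtain ⟨j0, O, hO1, hO2, hOv⟩ := exists_orth (vstar n) hv1
  set s : Fin (p n) → ℝ := fun k => if k = j0 then Real.sqrt (1 + lam ^ 2) else 1 with hs
  have hs0 : s j0 ^ 2 = 1 + lam ^ 2 := by
    simp only [hs, if_true]; exact Real.sq_sqrt (by positivity)
  have hs1 : ∀ k, k ≠ j0 → s k = 1 := fun k hk => by simp [hs, hk]
  have hlaw := Cmap_law (n := n) lam (vstar n) O s j0 hO1 hOv hs0 (fun k hk => by rw [hs1 k hk]; norm_num)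
  set E : Set (Fin (p n) → Fin n → ℝ) := {C | 1 / 4 ≤ (C j0 ⬝ᵥ C j0 - 1) ^ 2} ∪
    ⋃ k ∈ Finset.range (N + 1), ({C | t ≤ ‖qj (zk η k) C j0 - gj (zk η k) C j0‖ ^ 2} ∪ {C | n * t ≤ QQ (zk η k) C}) with hE
  have hsub : {uZ : (Fin n → ℝ) × (Fin n → Fin (p n) → ℝ) | ε < |dotp (vhat n uZ.1 uZ.2) (vstar n)|} ⊆
      Cmap lam (vstar n) O s ⁻¹' E := by
    intro uZ huZ
    by_contra hnot
    rw [Set.mem_preimage, hE, Set.mem_union, not_or] at hnot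
    obtain ⟨n1, n2⟩ := hnot
    rw [Set.mem_setOf_eq, not_le] at n1
    obtain ⟨c, hc1, hc2, hc3⟩ := core1 lam (vstar n) O s j0 hO2 hOv hv1 hs0 hs1 uZ (vhat n uZ.1 uZ.2)
      (hvhat n uZ.1 uZ.2) ε hε huZ n1
    refine hcore n (p n) hn e1 e2 (Cmap lam (vstar n) O s uZ) j0 c hc1 hc2 hc3 ?_
    intro k hk
    simp only [Set.mem_iUnion, not_exists, Set.mem_union, not_or, Set.mem_setOf_eq, not_le] at n2
    exact n2 k hk
  calc spikedLaw n (p n) _ ≤ spikedLaw n (p n) (Cmap lam (vstar n) O s ⁻¹' E) := measure_mono hsub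
    _ ≤ (spikedLaw n (p n)).map (Cmap lam (vstar n) O s) E :=
        Measure.le_map_apply (Cmap_cont lam (vstar n) O s).measurable.aemeasurable E
    _ = nu n (p n) E := by rw [hlaw]
    _ ≤ bd n := by
        rw [hE, hbd]
        refine (measure_union_le _ _).trans (add_le_add (prob_norm hn j0) ?_)
        refine (measure_biUnion_finset_le _ _).trans (Finset.sum_le_sum fun k _ => ?_)
        refine (measure_union_le _ _).trans (add_le_add ?_ ?_)
        · exact prob_qj hn (z := zk η k) hη j0 ht
        · exact prob_QQ hn (z := zk η k) hη ht
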